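/- arXiv:cond-mat/0004231 — 5 statements merged into one kernel-verified Lean document; each statement's English description precedes it below -/
import Mathlib

section
/- (Heilmann–Lieb.) Let H be a finite simple graph, and let M_H(w) = Σ_{M⊆E(H) matching} w^{|M|} be its matching polynomial (the independent-set polynomial of the line graph of H). Then every complex zero of M_H is a negative real number. -/
open Finset

/-- The matching polynomial of a finite simple graph `H`:
`M_H(w) = ∑_{M ⊆ E(H) matching} w^|M|`, where a matching is a set of pairwise
disjoint edges (no two distinct edges of `M` share an endpoint). -/
noncomputable def matchingPoly {V : Type*} [Fintype V] [DecidableEq V] (H : SimpleGraph V)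
    [DecidableRel H.Adj] : Polynomial ℂ :=
  ∑ M ∈ H.edgeFinset.powerset.filter
      (fun M => ∀ e ∈ M, ∀ f ∈ M, e ≠ f → ∀ v : V, ¬ (v ∈ e ∧ v ∈ f)),
    Polynomial.X ^ M.card

section HeilmannLieb

variable {V : Type*} [Fintype V] (H : SimpleGraph V)

open Classical in
/-- The matchings of `H` all of whose edges have both endpoints in `S`. -/
noncomputable def matchingsWithin (S : Finset V) : Finset (Finset (Sym2 V)) :=
  univ.filter fun M => (∀ e ∈ M, e ∈ H.edgeSet ∧ ∀ v ∈ e, v ∈ S) ∧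
    ∀ e ∈ M, ∀ f ∈ M, ∀ v ∈ e, v ∈ f → e = f

/-- The matching polynomial of the subgraph of `H` induced on `S`, evaluated at `z`. -/
noncomputable def matchingSum (z : ℂ) (S : Finset V) : ℂ :=
  ∑ M ∈ matchingsWithin H S, z ^ M.card

variable {H}

lemma mem_matchingsWithin {S : Finset V} {M : Finset (Sym2 V)} :
    M ∈ matchingsWithin H S ↔ (∀ e ∈ M, e ∈ H.edgeSet ∧ ∀ v ∈ e, v ∈ S) ∧
      ∀ e ∈ M, ∀ f ∈ M, ∀ v ∈ e, v ∈ f → e = f := by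
  simp [matchingsWithin]

lemma notMem_of_mem_matchingsWithin {S : Finset V} {M : Finset (Sym2 V)}
    (hM : M ∈ matchingsWithin H S) {v : V} (hv : v ∉ S) {e : Sym2 V} (he : v ∈ e) : e ∉ M :=
  fun h => hv (((mem_matchingsWithin.1 hM).1 e h).2 v he)

variable (H)

lemma matchingSum_empty (z : ℂ) : matchingSum H z ∅ = 1 := by
  have : matchingsWithin H ∅ = {∅} := by
    ext M
    rw [mem_matchingsWithin, mem_singleton]
    refine ⟨fun h => eq_empty_of_forall_notMem fun e he => ?_, by rintro rfl; simp⟩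
    exact absurd ((h.1 e he).2 _ e.out_fst_mem) (notMem_empty _)
  simp [matchingSum, this]

lemma matchingSum_zero (S : Finset V) : matchingSum H 0 S = 1 := by
  rw [matchingSum, Finset.sum_eq_single ∅]
  · simp
  · intro M _ hM
    simp [hM]
  · intro h
    exact absurd (mem_matchingsWithin.2 (by simp)) h

variable [DecidableEq V] [DecidableRel H.Adj]

lemma eval_matchingPoly (z : ℂ) : (matchingPoly H).eval z = matchingSum H z univ := by
  rw [matchingPoly, Polynomial.eval_finsetSum, matchingSum]
  refine Finset.sum_congr ?_ fun _ _ => by simp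
  ext M
  simp only [mem_filter, mem_powerset, mem_matchingsWithin, mem_univ, implies_true, and_true,
    Finset.subset_iff, SimpleGraph.mem_edgeFinset]
  refine and_congr_right fun _ => ⟨fun h e he f hf v hv hv' => ?_, fun h e he f hf hne v hv => ?_⟩
  · by_contra hne
    exact h e he f hf hne v ⟨hv, hv'⟩
  · exact hne (h e he f hf v hv.1 hv.2)

lemma matchingsWithin_eq_union {S : Finset V} {v : V} (hv : v ∈ S) :
    matchingsWithin H S = matchingsWithin H (S.erase v) ∪
      (S.filter (H.Adj v)).biUnion fun u =>
        (matchingsWithin H ((S.erase v).erase u)).image (insert s(v, u)) := by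
  ext M
  simp only [mem_union, mem_biUnion, mem_image, mem_filter]
  constructor
  · intro hM
    obtain ⟨h1, h2⟩ := mem_matchingsWithin.1 hM
    by_cases h : ∃ e ∈ M, v ∈ e
    · obtain ⟨e, heM, hve⟩ := h
      obtain ⟨u, rfl⟩ := Sym2.mem_iff_exists.1 hve
      refine Or.inr ⟨u, ⟨(h1 _ heM).2 u (by simp), (h1 _ heM).1⟩, M.erase s(v, u), ?_,
        insert_erase heM⟩
      refine mem_matchingsWithin.2 ⟨fun f hf => ?_, fun f hf g hg =>
        h2 f (mem_of_mem_erase hf) g (mem_of_mem_erase hg)⟩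
      obtain ⟨hne, hfM⟩ := mem_erase.1 hf
      refine ⟨(h1 f hfM).1, fun x hx => mem_erase.2 ⟨?_, mem_erase.2 ⟨?_, (h1 f hfM).2 x hx⟩⟩⟩
      · rintro rfl
        exact hne (h2 f hfM _ heM x hx (by simp))
      · rintro rfl
        exact hne (h2 f hfM _ heM x hx (by simp))
    · push Not at h
      refine Or.inl (mem_matchingsWithin.2 ⟨fun e he => ⟨(h1 e he).1, fun x hx =>
        mem_erase.2 ⟨?_, (h1 e he).2 x hx⟩⟩, h2⟩)
      rintro rfl
      exact h e he hx
  · rintro (hM | ⟨u, ⟨huS, hadj⟩, N, hN, rfl⟩)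
    · obtain ⟨h1, h2⟩ := mem_matchingsWithin.1 hM
      exact mem_matchingsWithin.2
        ⟨fun e he => ⟨(h1 e he).1, fun x hx => mem_of_mem_erase ((h1 e he).2 x hx)⟩, h2⟩
    · obtain ⟨h1, h2⟩ := mem_matchingsWithin.1 hN
      have key : ∀ e ∈ N, ∀ x ∈ e, x ∉ s(v, u) := by
        intro e he x hx hx'
        have := (h1 e he).2 x hx
        simp only [mem_erase] at this
        rcases Sym2.mem_iff.1 hx' with rfl | rfl
        · exact this.2.1 rfl
        · exact this.1 rfl
      refine mem_matchingsWithin.2 ⟨fun e he => ?_, fun e he f hf x hx hx' => ?_⟩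
      · rcases mem_insert.1 he with rfl | he
        · refine ⟨hadj, fun x hx => ?_⟩
          rcases Sym2.mem_iff.1 hx with rfl | rfl <;> assumption
        · exact ⟨(h1 e he).1, fun x hx =>
            mem_of_mem_erase (mem_of_mem_erase ((h1 e he).2 x hx))⟩
      · rcases mem_insert.1 he with rfl | he <;> rcases mem_insert.1 hf with rfl | hf
        · rfl
        · exact absurd hx (key f hf x hx')
        · exact absurd hx' (key e he x hx)
        · exact h2 e he f hf x hx hx'

lemma matchingSum_eq_add (z : ℂ) {S : Finset V} {v : V} (hv : v ∈ S) :
    matchingSum H z S = matchingSum H z (S.erase v) +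
      z * ∑ u ∈ S.filter (H.Adj v), matchingSum H z ((S.erase v).erase u) := by
  have hnot : ∀ u, ∀ N ∈ matchingsWithin H ((S.erase v).erase u), ∀ w, s(v, w) ∉ N :=
    fun u N hN w => notMem_of_mem_matchingsWithin hN (v := v) (by simp) (by simp)
  rw [matchingSum, matchingsWithin_eq_union H hv, sum_union, sum_biUnion, mul_sum]
  · refine congrArg₂ _ rfl (Finset.sum_congr rfl fun u _ => ?_)
    rw [sum_image, matchingSum, mul_sum]
    · refine Finset.sum_congr rfl fun N hN => ?_
      rw [card_insert_of_notMem (hnot u N hN u), pow_succ']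
    · intro N hN N' hN' h
      rw [← erase_insert (hnot u N hN u), ← erase_insert (hnot u N' hN' u)]
      exact congrArg (fun M => M.erase s(v, u)) h
  · intro u _ u' _ hne
    refine disjoint_left.2 fun M hM hM' => ?_
    obtain ⟨N, hN, rfl⟩ := mem_image.1 hM
    obtain ⟨N', hN', h⟩ := mem_image.1 hM'
    have hmem : s(v, u) ∈ insert s(v, u') N' := h ▸ mem_insert_self _ _
    rcases mem_insert.1 hmem with h | h
    · exact hne (Sym2.congr_right.1 h)
    · exact hnot u' N' hN' u h
  · refine disjoint_left.2 fun M hM hM' => ?_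
    obtain ⟨u, _, hM'⟩ := mem_biUnion.1 hM'
    obtain ⟨N, _, rfl⟩ := mem_image.1 hM'
    exact notMem_of_mem_matchingsWithin hM (v := v) (by simp) (e := s(v, u)) (by simp)
      (mem_insert_self _ _)

lemma Complex.inv_re_pos {q : ℂ} (hq : 0 < q.re) : 0 < q⁻¹.re := by
  rw [Complex.inv_re]
  exact div_pos hq (Complex.normSq_pos.2 fun h => by simp [h] at hq)

/-- If `0 < re s`, then the matching sum at `s ^ 2` does not vanish, and removing a vertex changes
it by a factor lying in a rotated right half-plane. -/
lemma matchingSum_sq_ne_zero {s : ℂ} (hs : 0 < s.re) (S : Finset V) :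
    matchingSum H (s ^ 2) S ≠ 0 ∧ ∀ v ∈ S,
      0 < (matchingSum H (s ^ 2) S / (s * matchingSum H (s ^ 2) (S.erase v))).re := by
  have hs0 : s ≠ 0 := fun h => by simp [h] at hs
  induction S using Finset.strongInduction with
  | H S ih =>
    have hre : ∀ v ∈ S,
        0 < (matchingSum H (s ^ 2) S / (s * matchingSum H (s ^ 2) (S.erase v))).re := by
      intro v hv
      obtain ⟨hne, hpos⟩ := ih _ (erase_ssubset hv)
      have hratio : matchingSum H (s ^ 2) S / (s * matchingSum H (s ^ 2) (S.erase v)) =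
          s⁻¹ + ∑ u ∈ S.filter (H.Adj v), (matchingSum H (s ^ 2) (S.erase v) /
            (s * matchingSum H (s ^ 2) ((S.erase v).erase u)))⁻¹ := by
        simp only [inv_div]
        rw [matchingSum_eq_add H _ hv, ← sum_div, ← mul_sum]
        field_simp
      rw [hratio, Complex.add_re, Complex.re_sum]
      refine add_pos_of_pos_of_nonneg (Complex.inv_re_pos hs) (sum_nonneg fun u hu => ?_)
      obtain ⟨huS, hadj⟩ := mem_filter.1 hu
      exact (Complex.inv_re_pos (hpos u (mem_erase.2 ⟨hadj.ne', huS⟩))).le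
    refine ⟨?_, hre⟩
    rcases S.eq_empty_or_nonempty with rfl | ⟨v, hv⟩
    · simp [matchingSum_empty]
    · intro h
      simpa [h] using hre v hv

end HeilmannLieb

lemma Complex.exists_sq_eq_of_mem_slitPlane {z : ℂ} (hz : z ∈ Complex.slitPlane) :
    ∃ s : ℂ, 0 < s.re ∧ s ^ 2 = z := by
  obtain ⟨s, rfl⟩ := IsAlgClosed.exists_pow_nat_eq z two_pos
  rcases lt_trichotomy s.re 0 with hs | hs | hs
  · exact ⟨-s, by simpa using hs, neg_sq s⟩
  · rw [Complex.mem_slitPlane_iff] at hz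
    simp [sq, hs, (mul_self_nonneg s.im).not_gt] at hz
  · exact ⟨s, hs, rfl⟩

/-- **Heilmann–Lieb**: every complex zero of the matching polynomial of a finite
simple graph is a negative real number. -/
theorem matchingPoly_zeros_negative_real {V : Type*} [Fintype V] [DecidableEq V]
    (H : SimpleGraph V) [DecidableRel H.Adj] (z : ℂ) (hz : (matchingPoly H).eval z = 0) :
    z.im = 0 ∧ z.re < 0 := by
  rw [eval_matchingPoly] at hz
  have hz0 : z ≠ 0 := by
    rintro rfl
    simp [matchingSum_zero] at hz
  have hslit : z ∉ Complex.slitPlane := by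
    intro h
    obtain ⟨s, hs, rfl⟩ := Complex.exists_sq_eq_of_mem_slitPlane h
    exact (matchingSum_sq_ne_zero H hs univ).1 hz
  rw [Complex.mem_slitPlane_iff] at hslit
  push Not at hslit
  refine ⟨hslit.2, hslit.1.lt_of_ne fun h => hz0 (Complex.ext h hslit.2)⟩
end

section
/- The set of all complex numbers that occur as a zero of the chromatic polynomial of some finite simple graph is dense in the entire complex plane ℂ. -/
/-- The number of proper `q`-colorings of a finite simple graph `G`. -/
noncomputable def properColoringCount {V : Type*} [Fintype V] (G : SimpleGraph V) (q : ℕ) : ℕ :=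
  Nat.card {σ : V → Fin q // ∀ x y, G.Adj x y → σ x ≠ σ y}

open Polynomial Filter Topology Metric

/-- `P` counts the proper `k`-colorings of `G` for every natural number `k`, including `0`. -/
def CountsColorings {V : Type*} [Fintype V] (G : SimpleGraph V) (P : ℂ[X]) : Prop :=
  ∀ k : ℕ, P.eval (k : ℂ) = (properColoringCount G k : ℂ)

/-- The roots of polynomials counting the proper colorings of a finite simple graph. -/
def chromaticRoots : Set ℂ :=
  {z | ∃ (n : ℕ) (G : SimpleGraph (Fin n)) (P : ℂ[X]), CountsColorings G P ∧ P.eval z = 0}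

lemma properColoringCount_comap {V W : Type*} [Fintype V] [Fintype W] (e : W ≃ V)
    (G : SimpleGraph V) (k : ℕ) :
    properColoringCount (G.comap e) k = properColoringCount G k := by
  refine Nat.card_congr ((Equiv.arrowCongr e (Equiv.refl (Fin k))).subtypeEquiv fun σ => ?_)
  simp only [SimpleGraph.comap_adj, Equiv.arrowCongr_apply, Equiv.coe_refl, Function.comp_apply,
    id_eq]
  constructor
  · intro h x y hxy
    exact h _ _ (by simpa using hxy)
  · intro h x y hxy
    simpa using h _ _ hxy

lemma mem_chromaticRoots {V : Type*} [Fintype V] {G : SimpleGraph V} {P : ℂ[X]}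
    (hP : CountsColorings G P) {z : ℂ} (hz : P.eval z = 0) : z ∈ chromaticRoots :=
  ⟨_, G.comap (Fintype.equivFin V).symm, P,
    fun k => by rw [properColoringCount_comap, hP k], hz⟩

lemma properColoringCount_zero {V : Type*} [Fintype V] [Nonempty V] (G : SimpleGraph V) :
    properColoringCount G 0 = 0 := by
  have : IsEmpty {σ : V → Fin 0 // ∀ x y, G.Adj x y → σ x ≠ σ y} :=
    ⟨fun σ => (σ.1 (Classical.arbitrary V)).elim0⟩
  exact Nat.card_of_isEmpty

/-- The cone over `G`: a new vertex `none` joined to every vertex of `G`. -/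
def coneGraph {V : Type*} (G : SimpleGraph V) : SimpleGraph (Option V) where
  Adj
    | none, none => False
    | none, some _ => True
    | some _, none => True
    | some x, some y => G.Adj x y
  symm := ⟨by rintro (_ | x) (_ | y) h <;> first | exact h | exact G.adj_symm h⟩
  loopless := ⟨by rintro (_ | x) h <;> first | exact h | exact G.irrefl h⟩

lemma properColoringCount_coneGraph {V : Type*} [Fintype V] (G : SimpleGraph V) (k : ℕ) :
    properColoringCount (coneGraph G) (k + 1) = (k + 1) * properColoringCount G k := by
  have key : Function.Bijective
      (fun cτ : Fin (k + 1) × {τ : V → Fin k // ∀ x y, G.Adj x y → τ x ≠ τ y} =>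
        (⟨fun v => v.elim cτ.1 fun x => cτ.1.succAbove (cτ.2.1 x), by
          rintro (_ | x) (_ | y) h
          · exact h.elim
          · exact (Fin.succAbove_ne _ _).symm
          · exact Fin.succAbove_ne _ _
          · exact fun h' => cτ.2.2 x y h (Fin.succAbove_right_injective h')⟩ :
          {σ : Option V → Fin (k + 1) // ∀ x y, (coneGraph G).Adj x y → σ x ≠ σ y})) := by
    constructor
    · rintro ⟨c, τ⟩ ⟨d, ρ⟩ h
      have h' := fun v => congrFun (congrArg Subtype.val h) v
      obtain rfl : c = d := h' none
      refine Prod.ext rfl (Subtype.ext (funext fun x => ?_))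
      exact Fin.succAbove_right_injective (h' (some x))
    · rintro ⟨σ, hσ⟩
      have hne : ∀ x, ∃ y, (σ none).succAbove y = σ (some x) := fun x =>
        Fin.exists_succAbove_eq (hσ (some x) none trivial)
      choose τ hτ using hne
      refine ⟨⟨σ none, τ, fun x y hxy h => hσ (some x) (some y) hxy ?_⟩, Subtype.ext ?_⟩
      · rw [← hτ, ← hτ, h]
      · funext v
        cases v with
        | none => rfl
        | some x => exact hτ x
  unfold properColoringCount
  rw [← Nat.card_congr (Equiv.ofBijective _ key), Nat.card_prod, Nat.card_fin]

lemma add_one_mem_chromaticRoots {z : ℂ} (hz : z ∈ chromaticRoots) : z + 1 ∈ chromaticRoots := by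
  obtain ⟨n, G, P, hP, hz⟩ := hz
  refine mem_chromaticRoots (G := coneGraph G) (P := X * P.comp (X - 1)) ?_ (by simp [hz])
  rintro (_ | k)
  · simp [properColoringCount_zero]
  · simp [properColoringCount_coneGraph, hP k]

/-- The polynomials counting the colorings of the `m` internal vertices of a path whose two end
vertices have prescribed colors, equal (first component) or distinct (second component). -/
noncomputable def pathPoly : ℕ → ℂ[X] × ℂ[X]
  | 0 => (0, 1)
  | m + 1 => ((X - 1) * (pathPoly m).2, (pathPoly m).1 + (X - 2) * (pathPoly m).2)

/-- `c` properly colors the internal vertices of a path with end vertices colored `a` and `b`. -/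
def IsPathColoring {k : ℕ} : (m : ℕ) → Fin k → (Fin m → Fin k) → Fin k → Prop
  | 0, a, _, b => a ≠ b
  | m + 1, a, c, b => a ≠ c 0 ∧ IsPathColoring m (c 0) (Fin.tail c) b

lemma isPathColoring_iff {k : ℕ} (m : ℕ) (a b : Fin k) (c : Fin m → Fin k) :
    IsPathColoring m a c b ↔ ∀ j : Fin (m + 1),
      (Fin.cons a (Fin.snoc c b : Fin (m + 1) → Fin k) : Fin (m + 2) → Fin k) j.castSucc ≠
        (Fin.snoc c b : Fin (m + 1) → Fin k) j := by
  induction m generalizing a with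
  | zero => simp [IsPathColoring, Fin.forall_fin_one, Fin.snoc]
  | succ m ih =>
    rw [IsPathColoring, ih, Fin.forall_fin_succ (n := m + 1)]
    have h : (Fin.snoc c b : Fin (m + 2) → Fin k) =
        Fin.cons (c 0) (Fin.snoc (Fin.tail c) b : Fin (m + 1) → Fin k) := by
      rw [Fin.cons_snoc_eq_snoc_cons]
      simp
    simp [h]

lemma card_isPathColoring {k : ℕ} (m : ℕ) (a b : Fin k) :
    (Nat.card {c : Fin m → Fin k // IsPathColoring m a c b} : ℂ) =
      if a = b then (pathPoly m).1.eval (k : ℂ) else (pathPoly m).2.eval (k : ℂ) := by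
  induction m generalizing a with
  | zero =>
    by_cases h : a = b <;> simp [IsPathColoring, pathPoly, h]
  | succ m ih =>
    let e : {c : Fin (m + 1) → Fin k // IsPathColoring (m + 1) a c b} ≃
        Σ x : {x : Fin k // a ≠ x}, {c : Fin m → Fin k // IsPathColoring m x c b} :=
      { toFun := fun c => ⟨⟨c.1 0, c.2.1⟩, ⟨Fin.tail c.1, c.2.2⟩⟩
        invFun := fun xc => ⟨Fin.cons xc.1.1 xc.2.1, by
          simpa [IsPathColoring] using ⟨xc.1.2, xc.2.2⟩⟩
        left_inv := fun c => Subtype.ext (by simp)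
        right_inv := fun xc => by
          rcases xc with ⟨⟨x, hx⟩, ⟨c, hc⟩⟩
          rfl }
    rw [Nat.card_congr e, Nat.card_sigma]
    push_cast
    simp_rw [ih]
    have h1 := Finset.sum_subtype (F := inferInstance) (Finset.univ.erase a)
      (p := fun x => a ≠ x) (by simp [eq_comm])
      (fun x => if x = b then (pathPoly m).1.eval (k : ℂ) else (pathPoly m).2.eval (k : ℂ))
    rw [← h1, Finset.sum_erase_eq_sub (Finset.mem_univ a)]
    have h2 : ∑ x : Fin k, (if x = b then (pathPoly m).1.eval (k : ℂ)
        else (pathPoly m).2.eval (k : ℂ)) =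
        (pathPoly m).1.eval (k : ℂ) + (k - 1) * (pathPoly m).2.eval (k : ℂ) := by
      rw [← Finset.add_sum_erase _ _ (Finset.mem_univ b), if_pos rfl,
        Finset.sum_congr rfl (g := fun _ => (pathPoly m).2.eval (k : ℂ))
          fun x hx => if_neg (Finset.ne_of_mem_erase hx)]
      simp [Finset.card_erase_of_mem, Nat.cast_sub (Fin.pos b)]
    rw [h2]
    by_cases h : a = b <;> simp [h, pathPoly]
    ring

/-- The vertices of the `i`-th strand of the generalized theta graph with `p` strands having `m`
internal vertices each. -/
def thetaStrand {p m : ℕ} (i : Fin p) : Fin (m + 2) → Bool ⊕ Fin p × Fin m :=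
  Fin.cons (Sum.inl false) (Fin.snoc (fun j => Sum.inr (i, j)) (Sum.inl true) :
    Fin (m + 1) → Bool ⊕ Fin p × Fin m)

/-- The generalized theta graph: `p` internally disjoint paths with `m` internal vertices each,
sharing their two end vertices. -/
def thetaGraph (p m : ℕ) : SimpleGraph (Bool ⊕ Fin p × Fin m) :=
  SimpleGraph.fromRel fun x y => ∃ (i : Fin p) (j : Fin (m + 1)),
    x = thetaStrand i j.castSucc ∧ y = thetaStrand i j.succ

lemma thetaStrand_injective {p m : ℕ} (i : Fin p) :
    Function.Injective (thetaStrand i : Fin (m + 2) → Bool ⊕ Fin p × Fin m) := by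
  unfold thetaStrand
  rw [Fin.cons_injective_iff]
  constructor
  · rintro ⟨j, hj⟩
    induction j using Fin.lastCases <;> simp at hj
  · rw [Fin.snoc_injective_iff]
    refine ⟨fun x y h => ?_, ?_⟩
    · simpa using h
    · rintro ⟨j, hj⟩
      simp at hj

lemma thetaGraph_proper_iff {p m k : ℕ} (σ : Bool ⊕ Fin p × Fin m → Fin k) :
    (∀ x y, (thetaGraph p m).Adj x y → σ x ≠ σ y) ↔
      ∀ i, IsPathColoring m (σ (Sum.inl false)) (fun j => σ (Sum.inr (i, j)))
        (σ (Sum.inl true)) := by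
  have hs : ∀ i : Fin p, (Fin.snoc (fun j : Fin m => σ (Sum.inr (i, j))) (σ (Sum.inl true)) :
      Fin (m + 1) → Fin k) = fun j => σ (thetaStrand i j.succ) := by
    intro i
    funext j
    induction j using Fin.lastCases <;> simp [thetaStrand]
  have hc : ∀ (i : Fin p) (j : Fin (m + 2)), (Fin.cons (σ (Sum.inl false))
      (fun j : Fin (m + 1) => σ (thetaStrand i j.succ)) : Fin (m + 2) → Fin k) j =
        σ (thetaStrand i j) := by
    intro i j
    induction j using Fin.cases <;> simp [thetaStrand]
  simp only [isPathColoring_iff, hs, hc]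
  constructor
  · intro h i j
    refine h _ _ ?_
    rw [thetaGraph, SimpleGraph.fromRel_adj]
    exact ⟨fun h' => (Fin.castSucc_lt_succ (i := j)).ne (thetaStrand_injective i h'),
      Or.inl ⟨i, j, rfl, rfl⟩⟩
  · intro h x y hxy
    rw [thetaGraph, SimpleGraph.fromRel_adj] at hxy
    obtain ⟨-, ⟨i, j, rfl, rfl⟩ | ⟨i, j, rfl, rfl⟩⟩ := hxy
    · exact h i j
    · exact (h i j).symm

lemma properColoringCount_thetaGraph (p m k : ℕ) :
    properColoringCount (thetaGraph p m) k = ∑ ab : Fin k × Fin k,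
      Nat.card {c : Fin m → Fin k // IsPathColoring m ab.1 c ab.2} ^ p := by
  let e : {σ : Bool ⊕ Fin p × Fin m → Fin k //
        ∀ x y, (thetaGraph p m).Adj x y → σ x ≠ σ y} ≃
      Σ ab : Fin k × Fin k, (Fin p → {c : Fin m → Fin k // IsPathColoring m ab.1 c ab.2}) :=
    { toFun := fun σ => ⟨(σ.1 (Sum.inl false), σ.1 (Sum.inl true)), fun i =>
        ⟨fun j => σ.1 (Sum.inr (i, j)), (thetaGraph_proper_iff σ.1).1 σ.2 i⟩⟩
      invFun := fun c => ⟨Sum.elim (fun b => if b then c.1.2 else c.1.1)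
        fun ij => (c.2 ij.1).1 ij.2,
          (thetaGraph_proper_iff _).2 fun i => by simpa using (c.2 i).2⟩
      left_inv := fun σ => Subtype.ext (by
        funext x
        rcases x with (_ | _) | ⟨i, j⟩ <;> rfl)
      right_inv := fun c => rfl }
  rw [properColoringCount, Nat.card_congr e, Nat.card_sigma]
  simp [Nat.card_pi]

lemma countsColorings_thetaGraph (p m : ℕ) :
    CountsColorings (thetaGraph p m)
      (X * ((pathPoly m).1 ^ p + (X - 1) * (pathPoly m).2 ^ p)) := by
  intro k
  rw [properColoringCount_thetaGraph, Fintype.sum_prod_type_right]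
  push_cast
  simp_rw [card_isPathColoring, ite_pow]
  have h : ∀ b : Fin k, ∑ x : Fin k, (if x = b then (pathPoly m).1.eval (k : ℂ) ^ p
      else (pathPoly m).2.eval (k : ℂ) ^ p) =
      (pathPoly m).1.eval (k : ℂ) ^ p + (k - 1) * (pathPoly m).2.eval (k : ℂ) ^ p := by
    intro b
    rw [← Finset.add_sum_erase _ _ (Finset.mem_univ b), if_pos rfl,
      Finset.sum_congr rfl (g := fun _ => (pathPoly m).2.eval (k : ℂ) ^ p)
        fun x hx => if_neg (Finset.ne_of_mem_erase hx)]
    simp [Finset.card_erase_of_mem, Nat.cast_sub (Fin.pos b)]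
  simp [h, mul_add]

lemma pathPoly_eval (m : ℕ) (w : ℂ) :
    (w + 1) * (pathPoly m).1.eval (w + 1) = (-1) ^ (m + 1) * ((-w) ^ (m + 1) + w) ∧
    (w + 1) * (pathPoly m).2.eval (w + 1) = (-1) ^ (m + 1) * ((-w) ^ (m + 1) - 1) := by
  induction m with
  | zero => simp [pathPoly, add_comm]
  | succ m ih =>
    simp only [pathPoly, eval_mul, eval_add, eval_sub, eval_X, eval_one, eval_ofNat]
    constructor
    · linear_combination w * ih.2
    · linear_combination ih.1 + (w - 1) * ih.2

lemma add_one_mem_chromaticRoots_of_pow_eq {m p : ℕ} {w : ℂ} (hw : w + 1 ≠ 0)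
    (h : ((-w) ^ (m + 1) + w) ^ p = -w * ((-w) ^ (m + 1) - 1) ^ p) :
    w + 1 ∈ chromaticRoots := by
  refine mem_chromaticRoots (countsColorings_thetaGraph p m) ?_
  obtain ⟨h1, h2⟩ := pathPoly_eval m w
  have h3 : (w + 1) ^ p * ((pathPoly m).1.eval (w + 1) ^ p +
      w * (pathPoly m).2.eval (w + 1) ^ p) = 0 := by
    rw [mul_add, ← mul_pow, h1, mul_left_comm, ← mul_pow, h2, mul_pow, h, mul_pow]
    ring
  simpa [hw] using h3

/-- If `‖g w‖ = 1` and `g` is not constant near `w`, then the solutions of the equations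
`g z ^ p = h z` accumulate at `w` as `p` varies. -/
lemma exists_pow_eq_of_norm_eq_one {g h : ℂ → ℂ} {w : ℂ} {U : Set ℂ} (hU : U ∈ 𝓝 w)
    (hg : AnalyticAt ℂ g w) (hh : AnalyticAt ℂ h w) (hgw : ‖g w‖ = 1)
    (hnc : ¬ ∀ᶠ z in 𝓝 w, g z = g w) (hhw : h w ≠ 0) :
    ∃ (p : ℕ), ∃ z ∈ U, g z ^ p = h z := by
  have hgw0 : g w ≠ 0 := norm_ne_zero_iff.1 (by rw [hgw]; exact one_ne_zero)
  set L : ℂ → ℂ := fun z => Complex.log (g z / g w) with hL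
  set M : ℂ → ℂ := fun z => Complex.log (h z / h w) with hM
  have hLa : AnalyticAt ℂ L w := (hg.div_const).clog (by simp [hgw0])
  have hMa : AnalyticAt ℂ M w := (hh.div_const).clog (by simp [hhw])
  have hLw : L w = 0 := by simp [hL]
  have hMw : M w = 0 := by simp [hM]
  have hg0 : ∀ᶠ z in 𝓝 w, g z ≠ 0 := hg.continuousAt.eventually_ne hgw0
  have hh0 : ∀ᶠ z in 𝓝 w, h z ≠ 0 := hh.continuousAt.eventually_ne hhw
  have hexpL : ∀ z, g z ≠ 0 → Complex.exp (L z) = g z / g w := fun z hz =>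
    Complex.exp_log (div_ne_zero hz hgw0)
  have hexpM : ∀ z, h z ≠ 0 → Complex.exp (M z) = h z / h w := fun z hz =>
    Complex.exp_log (div_ne_zero hz hhw)
  have hLne : ∀ᶠ z in 𝓝 w, z ≠ w → L z ≠ 0 := by
    rcases hLa.eventually_eq_zero_or_eventually_ne_zero with h0 | h0
    · refine absurd ?_ hnc
      filter_upwards [h0, hg0] with z hz hgz
      have := hexpL z hgz
      rw [hz, Complex.exp_zero] at this
      field_simp at this
      exact this.symm
    · exact eventually_nhdsWithin_iff.1 h0
  obtain ⟨r, hr, hball⟩ := (nhds_basis_closedBall.eventually_iff).1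
    (hLne.and (hLa.eventually_analyticAt.and
      (hMa.eventually_analyticAt.and (hg0.and (hh0.and hU)))))
  have hLon : AnalyticOnNhd ℂ L (closedBall w r) := fun z hz => (hball hz).2.1
  have hMon : AnalyticOnNhd ℂ M (closedBall w r) := fun z hz => (hball hz).2.2.1
  have hsphere : (sphere w r).Nonempty := NormedSpace.sphere_nonempty.2 hr.le
  obtain ⟨z₁, hz₁, hmin⟩ := (isCompact_sphere w r).exists_isMinOn hsphere
    (hLon.continuousOn.mono sphere_subset_closedBall).norm
  obtain ⟨C, hC⟩ := (isCompact_closedBall w r).exists_bound_of_continuousOn hMon.continuousOn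
  have hδ : 0 < ‖L z₁‖ :=
    norm_pos_iff.2 ((hball (sphere_subset_closedBall hz₁)).1 (ne_of_mem_sphere hz₁ hr.ne'))
  set δ := ‖L z₁‖
  have hC0 : 0 ≤ C := (norm_nonneg _).trans (hC w (mem_closedBall_self hr.le))
  set K := C + ‖Complex.log (h w)‖ + Real.pi with hK
  have hKpos : 0 < K := by positivity
  obtain ⟨p, hp⟩ := exists_nat_gt (4 * K / δ)
  have hp0 : (0 : ℝ) < p := lt_of_le_of_lt (by positivity) hp
  have hKp : K / p < δ / 4 := by
    rw [div_lt_iff₀ hδ] at hp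
    rw [div_lt_iff₀ hp0]
    linarith
  have hpC : (p : ℂ) ≠ 0 := by exact_mod_cast hp0.ne'
  set F : ℂ → ℂ := fun z => L z - M z / p with hF
  have hFon : AnalyticOnNhd ℂ F (closedBall w r) := hLon.sub hMon.div_const
  have hFw : F w = 0 := by simp [hF, hLw, hMw]
  have hFs : ∀ z ∈ sphere w r, δ / 2 ≤ ‖F z - F w‖ := by
    intro z hz
    have h1 : δ ≤ ‖L z‖ := hmin hz
    have h2 : ‖M z / p‖ ≤ K / p := by
      rw [norm_div, Complex.norm_natCast]
      gcongr
      have := hC z (sphere_subset_closedBall hz)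
      have := norm_nonneg (Complex.log (h w))
      linarith [Real.pi_pos]
    rw [hFw, sub_zero]
    have := norm_sub_norm_le (L z) (M z / p)
    simp only [hF]
    linarith
  have hFnc : ∃ᶠ z in 𝓝 w, F z ≠ F w := by
    intro hcon
    have := hFon.eqOn_of_preconnected_of_eventuallyEq analyticOnNhd_const
      (convex_closedBall w r).isPreconnected (mem_closedBall_self hr.le)
      (g := fun _ => F w) (by filter_upwards [hcon] with z hz using not_not.1 hz)
    have h1 := hFs z₁ hz₁
    rw [this (sphere_subset_closedBall hz₁), sub_self, norm_zero] at h1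
    linarith
  have hFd : DiffContOnCl ℂ F (ball w r) :=
    DifferentiableOn.diffContOnCl (hFon.differentiableOn.mono closure_ball_subset_closedBall)
  set c := Complex.log (h w) - Complex.log (g w ^ p) with hc
  have hlog : ‖Complex.log (g w ^ p)‖ ≤ Real.pi := by
    have h1 : Complex.log (g w ^ p) = (Complex.arg (g w ^ p) : ℂ) * Complex.I := by
      rw [Complex.log, norm_pow, hgw]
      simp
    rw [h1, norm_mul, Complex.norm_I, mul_one, Complex.norm_real]
    exact Complex.abs_arg_le_pi _
  have hcp : c / p ∈ ball (F w) (δ / 2 / 2) := by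
    rw [hFw, mem_ball_zero_iff, norm_div, Complex.norm_natCast]
    have h1 : ‖c‖ ≤ K := (norm_sub_le _ _).trans (by linarith)
    have h2 : ‖c‖ / p ≤ K / p := by gcongr
    linarith
  obtain ⟨z, hz, hFz⟩ := hFd.ball_subset_image_closedBall hr hFs hFnc hcp
  obtain ⟨-, -, -, hgz, hhz, hzU⟩ := hball hz
  refine ⟨p, z, hzU, ?_⟩
  have h1 : p * L z = M z + Complex.log (h w) - Complex.log (g w ^ p) := by
    simp only [hF, hc] at hFz
    field_simp at hFz
    linear_combination hFz
  have h2 := congrArg Complex.exp h1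
  rw [Complex.exp_nat_mul, Complex.exp_sub, Complex.exp_add, hexpL z hgz, hexpM z hhz,
    Complex.exp_log hhw, Complex.exp_log (pow_ne_zero _ hgw0), div_mul_cancel₀ _ hhw, div_pow] at h2
  exact (div_left_inj' (pow_ne_zero p hgw0)).1 h2

/-- If the analytic function `g` takes values of norm less and greater than one in a ball, then some
equation `g z ^ p = h z` has a solution in that ball. -/
lemma exists_pow_eq_of_norm_lt_one_lt {g h : ℂ → ℂ} {w₀ a b : ℂ} {r : ℝ}
    (hg : AnalyticOnNhd ℂ g (ball w₀ r)) (hh : AnalyticOnNhd ℂ h (ball w₀ r))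
    (hh0 : ∀ z ∈ ball w₀ r, h z ≠ 0) (ha : a ∈ ball w₀ r) (hb : b ∈ ball w₀ r)
    (hga : ‖g a‖ < 1) (hgb : 1 < ‖g b‖) :
    ∃ (p : ℕ), ∃ z ∈ ball w₀ r, g z ^ p = h z := by
  have hpc : IsPreconnected (ball w₀ r) := (convex_ball w₀ r).isPreconnected
  obtain ⟨w, hw, hgw⟩ := hpc.intermediate_value ha hb hg.continuousOn.norm ⟨hga.le, hgb.le⟩
  refine exists_pow_eq_of_norm_eq_one (isOpen_ball.mem_nhds hw) (hg w hw) (hh w hw) hgw ?_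
    (hh0 w hw)
  intro hcon
  have := hg.eqOn_of_preconnected_of_eventuallyEq (analyticOnNhd_const (v := g w)) hpc hw hcon ha
  rw [this] at hga
  exact hga.ne hgw

lemma normSq_add_sub_normSq_sub_one (u w : ℂ) :
    ‖u + w‖ ^ 2 - ‖u - 1‖ ^ 2 = 2 * (u * (starRingEnd ℂ) (w + 1)).re + ‖w‖ ^ 2 - 1 := by
  simp only [← Complex.normSq_eq_norm_sq, Complex.normSq_apply, Complex.add_re, Complex.add_im,
    Complex.sub_re, Complex.sub_im, Complex.one_re, Complex.one_im, Complex.mul_re,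
    Complex.conj_re, Complex.conj_im]
  ring

/-- Rotating `w` by an angle of size `O(1 / s)` gives `(-w) ^ s` any prescribed direction. -/
lemma exists_rotation_pow (w v : ℂ) {s : ℕ} (hs : 0 < s) :
    ∃ z : ℂ, ‖z‖ = ‖w‖ ∧ ‖z - w‖ ≤ ‖w‖ * (2 * Real.pi / s) ∧
      (-z) ^ s * (starRingEnd ℂ) v = ((‖w‖ ^ s * ‖v‖ : ℝ) : ℂ) := by
  set x := (-w) ^ s * (starRingEnd ℂ) v with hx
  have hsC : (s : ℂ) ≠ 0 := by exact_mod_cast hs.ne'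
  set θ : ℝ := -(x.arg / s) with hθ
  refine ⟨w * Complex.exp (Complex.I * θ), ?_, ?_, ?_⟩
  · rw [norm_mul, Complex.norm_exp_I_mul_ofReal, mul_one]
  · have h1 : w * Complex.exp (Complex.I * θ) - w = w * (Complex.exp (Complex.I * θ) - 1) := by ring
    rw [h1, norm_mul]
    gcongr
    refine Real.norm_exp_I_mul_ofReal_sub_one_le.trans ?_
    rw [hθ, Real.norm_eq_abs, abs_neg, abs_div, Nat.abs_cast]
    gcongr
    linarith [Complex.abs_arg_le_pi x, Real.pi_pos]
  · have h1 : (-(w * Complex.exp (Complex.I * θ))) ^ s * (starRingEnd ℂ) v =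
        x * Complex.exp (-(x.arg * Complex.I)) := by
      rw [← neg_mul, mul_pow, ← Complex.exp_nat_mul, hx]
      have : (s : ℂ) * (Complex.I * θ) = -(x.arg * Complex.I) := by
        rw [hθ]
        push_cast
        field_simp
      rw [this]
      ring
    rw [h1]
    nth_rewrite 1 [← Complex.norm_mul_exp_arg_mul_I x]
    rw [mul_assoc, ← Complex.exp_add, add_neg_cancel, Complex.exp_zero, mul_one, hx, norm_mul,
      norm_pow, norm_neg, RCLike.norm_conj]

/-- Near any point outside the closed unit disc the equations defining the chromatic roots of
generalized theta graphs have solutions. -/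
lemma exists_pow_eq_of_one_lt_norm {w₀ : ℂ} (hw₀ : 1 < ‖w₀‖) {ε : ℝ} (hε : 0 < ε) :
    ∃ (m p : ℕ), ∃ w ∈ ball w₀ ε, w + 1 ≠ 0 ∧
      ((-w) ^ (m + 1) + w) ^ p = -w * ((-w) ^ (m + 1) - 1) ^ p := by
  set q := w₀ + 1 with hq
  have hne : ∀ w : ℂ, 1 < ‖w‖ → w + 1 ≠ 0 := by
    intro w hw h
    rw [eq_neg_of_add_eq_zero_left h] at hw
    simp at hw
  have hq0 : 0 < ‖q‖ := norm_pos_iff.2 (hne w₀ hw₀)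
  obtain ⟨r, hr, hrε, hrw, hrq⟩ : ∃ r > 0, r ≤ ε ∧ r ≤ ‖w₀‖ - 1 ∧ r ≤ ‖q‖ / 2 :=
    ⟨min ε (min (‖w₀‖ - 1) (‖q‖ / 2)), by
      have := sub_pos.2 hw₀
      positivity, min_le_left _ _, (min_le_right _ _).trans (min_le_left _ _),
      (min_le_right _ _).trans (min_le_right _ _)⟩
  have hball : ∀ w ∈ ball w₀ r, 1 < ‖w‖ := by
    intro w hw
    rw [mem_ball, dist_eq_norm, norm_sub_rev] at hw
    linarith [norm_sub_norm_le w₀ w]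
  obtain ⟨m, hm1, hm2⟩ : ∃ m : ℕ, ‖w₀‖ * (2 * Real.pi / (m + 1 : ℕ)) < r ∧
      ‖w₀‖ ^ 2 < ‖w₀‖ ^ (m + 1) * ‖q‖ := by
    have h1 : Tendsto (fun m : ℕ => ‖w₀‖ * (2 * Real.pi / (m + 1 : ℕ))) atTop (𝓝 0) := by
      have := ((tendsto_const_div_atTop_nhds_zero_nat (2 * Real.pi)).comp
        (tendsto_add_atTop_nat 1)).const_mul ‖w₀‖
      simpa using this
    have h2 : Tendsto (fun m : ℕ => ‖w₀‖ ^ (m + 1) * ‖q‖) atTop atTop :=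
      ((tendsto_pow_atTop_atTop_of_one_lt hw₀).comp (tendsto_add_atTop_nat 1)).atTop_mul_const hq0
    exact ((h1.eventually_lt_const hr).and (h2.eventually_gt_atTop _)).exists
  set s := m + 1 with hs
  have hden : ∀ w ∈ ball w₀ r, (-w) ^ s - 1 ≠ 0 := by
    intro w hw h
    have h1 := congrArg norm (sub_eq_zero.1 h)
    rw [norm_pow, norm_neg, norm_one] at h1
    exact (one_lt_pow₀ (hball w hw) (by omega)).ne' h1
  obtain ⟨b, hbn, hbd, hb⟩ := exists_rotation_pow w₀ q (s := s) (by omega)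
  obtain ⟨a, han, had, ha⟩ := exists_rotation_pow w₀ (-q) (s := s) (by omega)
  have hab : a ∈ ball w₀ r := by
    rw [mem_ball, dist_eq_norm]
    exact had.trans_lt hm1
  have hbb : b ∈ ball w₀ r := by
    rw [mem_ball, dist_eq_norm]
    exact hbd.trans_lt hm1
  have hre : ∀ w ∈ ball w₀ r, ‖w‖ = ‖w₀‖ →
      |((-w) ^ s * (starRingEnd ℂ) (w + 1)).re - ((-w) ^ s * (starRingEnd ℂ) q).re| ≤
        ‖w₀‖ ^ s * (‖q‖ / 2) := by
    intro w hw hwn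
    rw [← Complex.sub_re, ← mul_sub, ← map_sub]
    refine (Complex.abs_re_le_norm _).trans ?_
    rw [norm_mul, norm_pow, norm_neg, hwn, RCLike.norm_conj]
    gcongr
    rw [mem_ball, dist_eq_norm] at hw
    rw [hq, add_sub_add_right_eq_sub]
    linarith
  have hga : ‖(-a) ^ s + a‖ < ‖(-a) ^ s - 1‖ := by
    have h1 := normSq_add_sub_normSq_sub_one ((-a) ^ s) a
    have h2 := (abs_le.1 (hre a hab han)).2
    have h3 := congrArg Complex.re ha
    rw [map_neg, mul_neg, Complex.neg_re, Complex.ofReal_re, norm_neg] at h3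
    refine lt_of_pow_lt_pow_left₀ 2 (norm_nonneg _) ?_
    rw [han] at h1
    linarith
  have hgb : ‖(-b) ^ s - 1‖ < ‖(-b) ^ s + b‖ := by
    have h1 := normSq_add_sub_normSq_sub_one ((-b) ^ s) b
    have h2 := (abs_le.1 (hre b hbb hbn)).1
    have h3 := congrArg Complex.re hb
    rw [Complex.ofReal_re] at h3
    refine lt_of_pow_lt_pow_left₀ 2 (norm_nonneg _) ?_
    rw [hbn] at h1
    have h4 : 0 < ‖w₀‖ ^ s * ‖q‖ := by positivity
    have h5 : 1 < ‖w₀‖ ^ 2 := one_lt_pow₀ hw₀ two_ne_zero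
    linarith
  obtain ⟨p, w, hw, hgw⟩ := exists_pow_eq_of_norm_lt_one_lt (w₀ := w₀) (r := r) (a := a) (b := b)
    (g := fun w => ((-w) ^ s + w) / ((-w) ^ s - 1)) (h := fun w => -w)
    (fun w hw => AnalyticAt.div (by fun_prop) (by fun_prop) (hden w hw)) (fun w _ => by fun_prop)
    (fun w hw h => by
      have := hball w hw
      rw [neg_eq_zero.1 h, norm_zero] at this
      linarith) hab hbb
    (by rw [norm_div, div_lt_one (norm_pos_iff.2 (hden a hab))]; exact hga)
    (by rw [norm_div, one_lt_div (norm_pos_iff.2 (hden b hbb))]; exact hgb)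
  refine ⟨m, p, w, ball_subset_ball hrε hw, hne w (hball w hw), ?_⟩
  have h1 := pow_ne_zero p (hden w hw)
  rwa [div_pow, div_eq_iff h1] at hgw

/-- **Sokal**: the set of complex numbers that occur as a zero of the chromatic polynomial
of some finite simple graph is dense in the entire complex plane.  Here the chromatic
polynomial of `G` is characterized as the polynomial whose value at each positive
integer `k` is the number of proper `k`-colorings of `G`. -/
theorem chromatic_roots_dense_in_plane :
    Dense {z : ℂ | ∃ (n : ℕ) (G : SimpleGraph (Fin n)) (P : Polynomial ℂ),
      (∀ k : ℕ, 0 < k → P.eval (k : ℂ) = (properColoringCount G k : ℂ)) ∧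
      P.eval z = 0} := by
  have hsub : chromaticRoots ⊆ {z : ℂ | ∃ (n : ℕ) (G : SimpleGraph (Fin n)) (P : Polynomial ℂ),
      (∀ k : ℕ, 0 < k → P.eval (k : ℂ) = (properColoringCount G k : ℂ)) ∧ P.eval z = 0} :=
    fun z ⟨n, G, P, hP, hz⟩ => ⟨n, G, P, fun k _ => hP k, hz⟩
  refine Dense.mono hsub (Metric.dense_iff.2 fun z ε hε => ?_)
  have near_of_one_lt : ∀ v : ℂ, 1 < ‖v - 1‖ → (ball v ε ∩ chromaticRoots).Nonempty := by
    intro v hv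
    obtain ⟨m, p, w, hw, hw1, h⟩ := exists_pow_eq_of_one_lt_norm hv hε
    refine ⟨w + 1, ?_, add_one_mem_chromaticRoots_of_pow_eq hw1 h⟩
    rw [mem_ball, dist_eq_norm] at hw ⊢
    convert hw using 2
    ring
  by_cases hz : 1 < ‖z - 1‖
  · exact near_of_one_lt z hz
  · have h3 : 1 < ‖z - 3 - 1‖ := by
      have h := norm_sub_norm_le (3 : ℂ) (z - 1)
      rw [norm_sub_rev 3, show z - 1 - 3 = z - 3 - 1 by ring, Complex.norm_ofNat] at h
      linarith
    obtain ⟨v, hv, hvr⟩ := near_of_one_lt (z - 3) h3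
    refine ⟨v + 1 + 1 + 1, ?_, add_one_mem_chromaticRoots
      (add_one_mem_chromaticRoots (add_one_mem_chromaticRoots hvr))⟩
    rw [mem_ball, dist_eq_norm] at hv ⊢
    convert hv using 2
    ring
end

section
/- Let S be a finite set, let P : S × S → ℝ be a stochastic matrix, and let Q : (S×S) × (S×S) → ℝ be a stochastic matrix that is a Markovian coupling of P with itself, i.e., Σ_{y'∈S} Q((x,y),(x',y')) = P(x,x') for all x, y, x', and Σ_{x'∈S} Q((x,y),(x',y')) = P(y,y') for all x, y, y'. Let Φ : S × S → [0,∞) satisfy Φ(x,y) > 0 whenever x ≠ y, and suppose there is β ≥ 0 such that Σ_{(x',y')} Q((x,y),(x',y'))·Φ(x',y') ≤ β·Φ(x,y) for all (x,y). Then for every f : S → ℝ and every L ≥ 0 such that |f(x) − f(y)| ≤ L·Φ(x,y) for all x, y ∈ S, one has |(Pf)(x) − (Pf)(y)| ≤ β·L·Φ(x,y) for all x, y ∈ S; that is, the Lipschitz seminorm ‖f‖_{Lip(Φ)} = sup_{x≠y} |f(x)−f(y)|/Φ(x,y) satisfies ‖Pf‖_{Lip(Φ)} ≤ β·‖f‖_{Lip(Φ)},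 where (Pf)(x) = Σ_{x'} P(x,x') f(x'). -/
/-- If `Q` is a Markovian coupling of the stochastic matrix `P` with itself and `Φ` is a
Lyapunov function contracted by factor `β` under `Q`, then `P` contracts the Lipschitz
seminorm associated to `Φ` by the factor `β`:  if `|f x - f y| ≤ L·Φ(x,y)` for all
`x, y`, then `|(Pf) x - (Pf) y| ≤ β·L·Φ(x,y)` for all `x, y`. -/
theorem lipschitz_contraction_of_coupling {S : Type*} [Fintype S]
    (P : Matrix S S ℝ) (hP0 : ∀ x y, 0 ≤ P x y) (hProw : ∀ x, ∑ y, P x y = 1)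
    (Q : Matrix (S × S) (S × S) ℝ) (hQ0 : ∀ a b, 0 ≤ Q a b) (hQrow : ∀ a, ∑ b, Q a b = 1)
    (hmarg₁ : ∀ x y x' : S, ∑ y' : S, Q (x, y) (x', y') = P x x')
    (hmarg₂ : ∀ x y y' : S, ∑ x' : S, Q (x, y) (x', y') = P y y')
    (Φ : S → S → ℝ) (hΦ0 : ∀ x y, 0 ≤ Φ x y) (hΦpos : ∀ x y, x ≠ y → 0 < Φ x y)
    (β : ℝ) (hβ : 0 ≤ β)
    (hLyap : ∀ x y : S, ∑ p : S × S, Q (x, y) p * Φ p.1 p.2 ≤ β * Φ x y)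
    (f : S → ℝ) (L : ℝ) (hL : 0 ≤ L) (hf : ∀ x y : S, |f x - f y| ≤ L * Φ x y) :
    ∀ x y : S, |(∑ x' : S, P x x' * f x') - ∑ y' : S, P y y' * f y'| ≤ β * L * Φ x y := by
  intro x y
  have h₁ : ∑ x' : S, P x x' * f x' = ∑ p : S × S, Q (x, y) p * f p.1 := by
    simp only [Fintype.sum_prod_type, ← hmarg₁ x y, Finset.sum_mul]
  have h₂ : ∑ y' : S, P y y' * f y' = ∑ p : S × S, Q (x, y) p * f p.2 := by
    simp only [Fintype.sum_prod_type_right, ← hmarg₂ x y, Finset.sum_mul]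
  rw [h₁, h₂, ← Finset.sum_sub_distrib]
  calc |∑ p : S × S, (Q (x, y) p * f p.1 - Q (x, y) p * f p.2)|
      ≤ ∑ p : S × S, |Q (x, y) p * f p.1 - Q (x, y) p * f p.2| :=
        Finset.abs_sum_le_sum_abs _ _
    _ ≤ ∑ p : S × S, L * (Q (x, y) p * Φ p.1 p.2) := by
        refine Finset.sum_le_sum fun p _ => ?_
        rw [← mul_sub, abs_mul, abs_of_nonneg (hQ0 _ _), mul_left_comm]
        exact mul_le_mul_of_nonneg_left (hf _ _) (hQ0 _ _)
    _ = L * ∑ p : S × S, Q (x, y) p * Φ p.1 p.2 := by rw [Finset.mul_sum]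
    _ ≤ L * (β * Φ x y) := mul_le_mul_of_nonneg_left (hLyap x y) hL
    _ = β * L * Φ x y := by ring
end

section
/- (Ergodicity of single-edge dynamics for q ≥ Δ+1.) Let G=(V,E) be a finite simple graph of maximum degree Δ, and let q ≥ Δ + 1 be an integer. Then for any two proper q-colorings σ and τ of G, there exists a finite sequence of proper q-colorings σ = σ_0, σ_1, …, σ_k = τ such that each σ_{i+1} differs from σ_i either at exactly one vertex or at exactly two adjacent vertices. -/
namespace SimpleGraph

variable {V α : Type*} (G : SimpleGraph V)

/-- `σ` assigns different colors to adjacent vertices. -/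
def IsProperColoring (σ : V → α) : Prop := ∀ x y, G.Adj x y → σ x ≠ σ y

/-- Two proper colorings which differ at exactly one vertex or at exactly two adjacent vertices. -/
def EdgeStep (a b : V → α) : Prop :=
  (∀ x y, G.Adj x y → a x ≠ a y) ∧ (∀ x y, G.Adj x y → b x ≠ b y) ∧
    ((∃ v : V, a v ≠ b v ∧ ∀ u : V, u ≠ v → a u = b u) ∨
     (∃ v u : V, G.Adj v u ∧ a v ≠ b v ∧ a u ≠ b u ∧
        ∀ z : V, z ≠ v → z ≠ u → a z = b z))

variable {G}

lemma EdgeStep.symm {a b : V → α} (h : G.EdgeStep a b) : G.EdgeStep b a := by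
  obtain ⟨ha, hb, ⟨v, h1, h2⟩ | ⟨v, u, h0, h1, h2, h3⟩⟩ := h
  · exact ⟨hb, ha, .inl ⟨v, h1.symm, fun u hu => (h2 u hu).symm⟩⟩
  · exact ⟨hb, ha, .inr ⟨v, u, h0, h1.symm, h2.symm, fun z hz hz' => (h3 z hz hz').symm⟩⟩

open Classical in
lemma IsProperColoring.update {σ : V → α} (hσ : G.IsProperColoring σ) {u : V} {e : α}
    (he : ∀ x, G.Adj u x → σ x ≠ e) : G.IsProperColoring (Function.update σ u e) := by
  intro x y hxy
  have hne := hxy.ne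
  by_cases hx : x = u
  · subst hx
    simpa [Function.update_of_ne hne.symm] using (he y hxy).symm
  · by_cases hy : y = u
    · subst hy
      simpa [Function.update_of_ne hne] using he x hxy.symm
    · simpa [hx, hy] using hσ x y hxy

open Classical in
lemma IsProperColoring.edgeStep_update {σ : V → α} (hσ : G.IsProperColoring σ) {u : V} {e : α}
    (he : ∀ x, G.Adj u x → σ x ≠ e) (hne : σ u ≠ e) : G.EdgeStep σ (Function.update σ u e) :=
  ⟨hσ, hσ.update he, .inl ⟨u, by simpa using hne, fun x hx => by simp [hx]⟩⟩

open Classical in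
lemma IsProperColoring.edgeStep_update_update {σ : V → α} (hσ : G.IsProperColoring σ) {u v : V}
    {d : α} (huv : G.Adj u v) (hu : ∀ x, x ≠ v → G.Adj u x → σ x ≠ σ v)
    (hd : ∀ x, x ≠ u → G.Adj v x → σ x ≠ d) (hne : σ v ≠ d) :
    G.EdgeStep σ (Function.update (Function.update σ u (σ v)) v d) := by
  have huv' := huv.ne
  refine ⟨hσ, ?_, .inr ⟨u, v, huv, ?_, by simpa using hne, fun z hz hz' => by simp [hz, hz']⟩⟩
  · intro x y hxy
    have := hxy.ne
    have := hxy.symm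
    have := hσ x y hxy
    simp only [Function.update_apply]
    grind
  · simpa [huv'] using hσ u v huv

open Classical in
/-- A single step brings the color class of `c` closer to a given independent set. -/
lemma IsProperColoring.exists_edgeStep_card_lt {S : Finset V} {A : Finset α} {I : Finset V}
    {c : α} (hdeg : ∀ v ∈ S, (S.filter (G.Adj v)).card < A.card) (hc : c ∈ A) (hIS : I ⊆ S)
    (hI : ∀ x ∈ I, ∀ y ∈ I, ¬ G.Adj x y) {σ : V → α} (hσ : G.IsProperColoring σ)
    (hSA : ∀ x, x ∈ S ↔ σ x ∈ A) {v : V} (hv : v ∈ I) (hvc : σ v ≠ c) :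
    ∃ σ' : V → α, G.EdgeStep σ σ' ∧ (∀ x, x ∈ S ↔ σ' x ∈ A) ∧ (∀ x, x ∉ S → σ' x = σ x) ∧
      (S.filter fun x => ¬(x ∈ I ↔ σ' x = c)).card <
        (S.filter fun x => ¬(x ∈ I ↔ σ x = c)).card := by
  have hvS := hIS hv
  by_cases hu : ∃ u, G.Adj v u ∧ σ u = c
  · obtain ⟨u, hvu, huc⟩ := hu
    have huS : u ∈ S := (hSA u).2 (huc ▸ hc)
    have huI : u ∉ I := fun h => hI v hv u h hvu
    by_cases hw : ∃ w, w ≠ v ∧ G.Adj u w ∧ σ w = σ v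
    · obtain ⟨w, hwv, huw, hwc⟩ := hw
      have hwS : w ∈ S := by rw [hSA, hwc, ← hSA]; exact hvS
      obtain ⟨e, heA, he⟩ := Finset.exists_mem_notMem_of_card_lt_card
        (s := insert c (((S.filter (G.Adj u)).erase v).image σ)) (t := A) (by
          have h1 := Finset.card_erase_add_one
            (show v ∈ S.filter (G.Adj u) by simp [hvS, hvu.symm])
          have h2 := Finset.card_image_le (s := (S.filter (G.Adj u)).erase v) (f := σ)
          have h3 := Finset.card_insert_le c (((S.filter (G.Adj u)).erase v).image σ)
          have h4 := hdeg u huS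
          omega)
      simp only [Finset.mem_insert, Finset.mem_image, Finset.mem_erase, Finset.mem_filter,
        not_or, not_exists, not_and, and_imp] at he
      refine ⟨Function.update σ u e, hσ.edgeStep_update ?_ (by grind), ?_, ?_, ?_⟩
      · intro x hx hxe
        have hxS : x ∈ S := (hSA x).2 (hxe ▸ heA)
        by_cases hxv : x = v
        · exact he.2 w hwv hwS huw (by rw [hwc, ← hxv, hxe])
        · exact he.2 x hxv hxS hx hxe
      · intro x; simp only [Function.update_apply]; grind
      · intro x hx; simp only [Function.update_apply]; grind
      · apply Finset.card_lt_card
        refine Finset.ssubset_iff_of_subset ?_ |>.2 ⟨u, ?_, ?_⟩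
        · intro x; simp only [Function.update_apply, Finset.mem_filter]; grind
        · simp [huS, huI, huc]
        · simp [huI, he.1]
    · obtain ⟨d, hdA, hd⟩ := Finset.exists_mem_notMem_of_card_lt_card
        (s := insert (σ v) (((S.filter (G.Adj v)).erase u).image σ)) (t := A) (by
          have h1 := Finset.card_erase_add_one
            (show u ∈ S.filter (G.Adj v) by simp [huS, hvu])
          have h2 := Finset.card_image_le (s := (S.filter (G.Adj v)).erase u) (f := σ)
          have h3 := Finset.card_insert_le (σ v) (((S.filter (G.Adj v)).erase u).image σ)
          have h4 := hdeg v hvS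
          omega)
      simp only [Finset.mem_insert, Finset.mem_image, Finset.mem_erase, Finset.mem_filter,
        not_or, not_exists, not_and, and_imp] at hd
      have hne := hvu.ne
      refine ⟨_, hσ.edgeStep_update_update (d := d) hvu.symm
        (fun x hxv hux h => hw ⟨x, hxv, hux, h⟩) ?_ (Ne.symm hd.1), ?_, ?_, ?_⟩
      · intro x hxu hx hxd
        exact hd.2 x hxu ((hSA x).2 (hxd ▸ hdA)) hx hxd
      · intro x; simp only [Function.update_apply]; grind
      · intro x hx; simp only [Function.update_apply]; grind
      · apply Finset.card_lt_card
        refine Finset.ssubset_iff_of_subset ?_ |>.2 ⟨u, ?_, ?_⟩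
        · intro x; simp only [Function.update_apply, Finset.mem_filter]; grind
        · simp [huS, huI, huc]
        · simp [huI, hvc, hne.symm]
  · push Not at hu
    refine ⟨Function.update σ v c, hσ.edgeStep_update hu hvc, ?_, ?_, ?_⟩
    · intro x; simp only [Function.update_apply]; grind
    · intro x hx; simp only [Function.update_apply]; grind
    · apply Finset.card_lt_card
      refine Finset.ssubset_iff_of_subset ?_ |>.2 ⟨v, ?_, ?_⟩
      · intro x; simp only [Function.update_apply, Finset.mem_filter]; grind
      · simp [hvS, hv, hvc]
      · simp [hv]

open Classical in
/-- Every proper coloring can be moved to one in which a given independent set has color `c`. -/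
lemma IsProperColoring.exists_reflTransGen_edgeStep_forall_mem_eq {S : Finset V} {A : Finset α}
    {I : Finset V} {c : α} (hdeg : ∀ v ∈ S, (S.filter (G.Adj v)).card < A.card) (hc : c ∈ A)
    (hIS : I ⊆ S) (hI : ∀ x ∈ I, ∀ y ∈ I, ¬ G.Adj x y) {σ : V → α}
    (hσ : G.IsProperColoring σ) (hSA : ∀ x, x ∈ S ↔ σ x ∈ A) :
    ∃ σ' : V → α, Relation.ReflTransGen G.EdgeStep σ σ' ∧ G.IsProperColoring σ' ∧
      (∀ x, x ∈ S ↔ σ' x ∈ A) ∧ (∀ x, x ∉ S → σ' x = σ x) ∧ ∀ x ∈ I, σ' x = c := by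
  induction hm : (S.filter fun x => ¬(x ∈ I ↔ σ x = c)).card using Nat.strong_induction_on
    generalizing σ with
  | _ m ih =>
    by_cases h : ∀ x ∈ I, σ x = c
    · exact ⟨σ, .refl, hσ, hSA, fun _ _ => rfl, h⟩
    · push Not at h
      obtain ⟨v, hv, hvc⟩ := h
      obtain ⟨ρ, hstep, hρA, hρS, hlt⟩ :=
        hσ.exists_edgeStep_card_lt hdeg hc hIS hI hSA hv hvc
      obtain ⟨σ', hreach, hσ', hA, hS, hc'⟩ := ih _ (hm ▸ hlt) hstep.2.1 hρA rfl
      exact ⟨σ', hreach.head hstep, hσ', hA,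
        fun x hx => (hS x hx).trans (hρS x hx), hc'⟩

open Classical in
lemma exists_maximal_independent_subset (G : SimpleGraph V) (S : Finset V) :
    ∃ I ⊆ S, (∀ x ∈ I, ∀ y ∈ I, ¬ G.Adj x y) ∧ ∀ x ∈ S, x ∉ I → ∃ y ∈ I, G.Adj x y := by
  obtain ⟨I, hI, hmax⟩ := Finset.exists_max_image
    (S.powerset.filter fun I => ∀ x ∈ I, ∀ y ∈ I, ¬ G.Adj x y) Finset.card ⟨∅, by simp⟩
  simp only [Finset.mem_filter, Finset.mem_powerset] at hI hmax
  refine ⟨I, hI.1, hI.2, fun x hxS hxI => ?_⟩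
  by_contra! h
  have := hmax (insert x I) ⟨Finset.insert_subset hxS hI.1, ?_⟩
  · rw [Finset.card_insert_of_notMem hxI] at this
    omega
  · have h' : ∀ y ∈ I, ¬ G.Adj y x := fun y hy hyx => h y hy hyx.symm
    have := hI.2
    have := G.irrefl (v := x)
    simp only [Finset.mem_insert]
    rintro a (rfl | ha) b (rfl | hb) <;> simp_all

open Classical in
/-- Two proper colorings which agree off `S` and use on `S` exactly the colors from `A` are
connected, provided that every vertex of `S` has fewer than `#A` neighbors in `S`. -/
lemma reflTransGen_edgeStep_of_card_lt {S : Finset V} {A : Finset α}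
    (hdeg : ∀ v ∈ S, (S.filter (G.Adj v)).card < A.card) {σ τ : V → α}
    (hσ : G.IsProperColoring σ) (hτ : G.IsProperColoring τ)
    (hσA : ∀ x, x ∈ S ↔ σ x ∈ A) (hτA : ∀ x, x ∈ S ↔ τ x ∈ A)
    (hστ : ∀ x, x ∉ S → σ x = τ x) : Relation.ReflTransGen G.EdgeStep σ τ := by
  induction hn : A.card generalizing A S σ τ with
  | zero =>
    obtain rfl : σ = τ := funext fun x => hστ x fun hx => by
      have := hdeg x hx
      omega
    exact .refl
  | succ n ih =>
    obtain ⟨c, hc⟩ : A.Nonempty := Finset.card_pos.1 (by omega)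
    obtain ⟨I, hIS, hI, hmax⟩ := G.exists_maximal_independent_subset S
    obtain ⟨σ', hσr, hσ', hσ'A, hσS, hσc⟩ :=
      hσ.exists_reflTransGen_edgeStep_forall_mem_eq hdeg hc hIS hI hσA
    obtain ⟨τ', hτr, hτ', hτ'A, hτS, hτc⟩ :=
      hτ.exists_reflTransGen_edgeStep_forall_mem_eq hdeg hc hIS hI hτA
    have hclass : ∀ ρ : V → α, G.IsProperColoring ρ → (∀ x, x ∈ S ↔ ρ x ∈ A) →
        (∀ x ∈ I, ρ x = c) → ∀ x, x ∈ S \ I ↔ ρ x ∈ A.erase c := by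
      intro ρ hρ hρA hρc x
      have : x ∈ S → x ∉ I → ρ x ≠ c := fun hxS hxI => by
        obtain ⟨y, hy, hxy⟩ := hmax x hxS hxI
        exact hρc y hy ▸ hρ x y hxy
      grind
    have hmid : Relation.ReflTransGen G.EdgeStep σ' τ' := by
      refine ih (S := S \ I) (A := A.erase c) ?_ hσ' hτ' (hclass σ' hσ' hσ'A hσc)
        (hclass τ' hτ' hτ'A hτc) ?_ (by rw [Finset.card_erase_of_mem hc]; omega)
      · intro v hv
        obtain ⟨hvS, hvI⟩ := Finset.mem_sdiff.1 hv
        obtain ⟨y, hy, hvy⟩ := hmax v hvS hvI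
        have hlt : ((S \ I).filter (G.Adj v)).card < (S.filter (G.Adj v)).card :=
          Finset.card_lt_card <| (Finset.ssubset_iff_of_subset
            (Finset.filter_subset_filter _ Finset.sdiff_subset)).2
            ⟨y, by simp [hIS hy, hvy], by simp [hy]⟩
        have := hdeg v hvS
        rw [Finset.card_erase_of_mem hc]
        omega
      · intro x hx
        by_cases hxI : x ∈ I
        · rw [hσc x hxI, hτc x hxI]
        · have hxS : x ∉ S := fun h => hx (Finset.mem_sdiff.2 ⟨h, hxI⟩)
          rw [hσS x hxS, hτS x hxS, hστ x hxS]
    have : Std.Symm (G.EdgeStep (α := α)) := ⟨fun _ _ h => h.symm⟩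
    exact (hσr.trans hmid).trans (Relation.ReflTransGen.stdSymm.symm _ _ hτr)

end SimpleGraph


/-- **Ergodicity of single-edge dynamics for `q ≥ Δ + 1`**:  if `G` is a finite simple
graph of maximum degree `Δ` and `q ≥ Δ + 1`, then any two proper `q`-colorings are
connected by a finite sequence of proper `q`-colorings in which consecutive colorings
differ either at exactly one vertex or at exactly two adjacent vertices. -/
theorem single_edge_dynamics_ergodic {V : Type*} [Fintype V] (G : SimpleGraph V)
    [DecidableRel G.Adj] (q : ℕ) (hq : G.maxDegree + 1 ≤ q)
    (σ τ : V → Fin q)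
    (hσ : ∀ x y, G.Adj x y → σ x ≠ σ y) (hτ : ∀ x y, G.Adj x y → τ x ≠ τ y) :
    Relation.ReflTransGen
      (fun a b : V → Fin q =>
        (∀ x y, G.Adj x y → a x ≠ a y) ∧ (∀ x y, G.Adj x y → b x ≠ b y) ∧
        ((∃ v : V, a v ≠ b v ∧ ∀ u : V, u ≠ v → a u = b u) ∨
         (∃ v u : V, G.Adj v u ∧ a v ≠ b v ∧ a u ≠ b u ∧
            ∀ z : V, z ≠ v → z ≠ u → a z = b z)))
      σ τ := by
  classical
  refine SimpleGraph.reflTransGen_edgeStep_of_card_lt (S := Finset.univ) (A := Finset.univ)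
    (fun v _ => ?_) hσ hτ (by simp) (by simp) (by simp)
  have h := G.degree_le_maxDegree v
  rw [← G.card_neighborFinset_eq_degree, G.neighborFinset_eq_filter] at h
  rw [Finset.card_univ, Fintype.card_fin]
  refine lt_of_le_of_lt (le_of_eq ?_) (lt_of_le_of_lt h hq)
  congr
end

section
/- (Ergodicity of Wang–Swendsen–Kotecký dynamics on bipartite graphs.) Let G=(V,E) be a finite bipartite simple graph and let q ≥ 1 be an integer. Then for any two proper q-colorings σ and τ of G, there exists a finite sequence of proper q-colorings σ = σ_0, σ_1, …, σ_k = τ such that each σ_{i+1} is obtained from σ_i by a single Kempe (WSK) move: choose two distinct colors α, β ∈ {1,…,q} and a connected component C of the subgraph of G induced by the vertices colored α or β under σ_i, and interchange the colors α and β on the vertices of C. -/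
/-- A single Kempe (Wang–Swendsen–Kotecký) move taking the coloring `a` to the coloring
`b`:  there are distinct colors `α, β` and a connected component (here, the reachability
class of some vertex `x₀`) of the subgraph of `G` induced by the vertices colored `α` or
`β` under `a`, such that `b` is obtained from `a` by interchanging `α` and `β` on that
component and leaving all the other vertices unchanged. -/
def KempeStep {V : Type*} (G : SimpleGraph V) {q : ℕ} (a b : V → Fin q) : Prop :=
  ∃ α β : Fin q, α ≠ β ∧
    ∃ x₀ : ↥{y : V | a y = α ∨ a y = β},
      (∀ (x : V) (hx : a x = α ∨ a x = β),
        ((G.induce {y : V | a y = α ∨ a y = β}).Reachable x₀ ⟨x, hx⟩ →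
          b x = if a x = α then β else α) ∧
        (¬ (G.induce {y : V | a y = α ∨ a y = β}).Reachable x₀ ⟨x, hx⟩ → b x = a x)) ∧
      (∀ x : V, ¬ (a x = α ∨ a x = β) → b x = a x)

/-- Reachability in an induced subgraph only depends on the inducing set up to equality. -/
theorem reachable_induce_congr {V : Type*} (G : SimpleGraph V) {s t : Set V} (h : s = t)
    {x y : V} (hx : x ∈ s) (hy : y ∈ s) (hx' : x ∈ t) (hy' : y ∈ t) :
    (G.induce s).Reachable ⟨x, hx⟩ ⟨y, hy⟩ ↔ (G.induce t).Reachable ⟨x, hx'⟩ ⟨y, hy'⟩ := by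
  subst h
  rfl

/-- Kempe moves preserve the set of vertices carrying one of the two colors. -/
theorem kempe_mem_iff {V : Type*} {G : SimpleGraph V} {q : ℕ} {a b : V → Fin q}
    {α β : Fin q} {x₀ : ↥{y : V | a y = α ∨ a y = β}}
    (h₁ : ∀ (x : V) (hx : a x = α ∨ a x = β),
        ((G.induce {y : V | a y = α ∨ a y = β}).Reachable x₀ ⟨x, hx⟩ →
          b x = if a x = α then β else α) ∧
        (¬ (G.induce {y : V | a y = α ∨ a y = β}).Reachable x₀ ⟨x, hx⟩ → b x = a x))
    (h₂ : ∀ x : V, ¬ (a x = α ∨ a x = β) → b x = a x) (x : V) :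
    (b x = α ∨ b x = β) ↔ (a x = α ∨ a x = β) := by
  by_cases hx : a x = α ∨ a x = β
  · by_cases hr : (G.induce {y : V | a y = α ∨ a y = β}).Reachable x₀ ⟨x, hx⟩
    · have := (h₁ x hx).1 hr
      grind
    · rw [(h₁ x hx).2 hr]
  · rw [h₂ x hx]

/-- Kempe moves are reversible. -/
theorem KempeStep.symm {V : Type*} {G : SimpleGraph V} {q : ℕ} {a b : V → Fin q}
    (h : KempeStep G a b) : KempeStep G b a := by
  obtain ⟨α, β, hne, ⟨x₀, hx₀⟩, h₁, h₂⟩ := h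
  have hmem := kempe_mem_iff h₁ h₂
  have hset : {y : V | b y = α ∨ b y = β} = {y : V | a y = α ∨ a y = β} := Set.ext hmem
  refine ⟨α, β, hne, ⟨x₀, (hmem x₀).2 hx₀⟩, fun x hx => ?_, fun x hx => ?_⟩
  · have hx' := (hmem x).1 hx
    rw [reachable_induce_congr G hset ((hmem x₀).2 hx₀) hx hx₀ hx']
    refine ⟨fun hr => ?_, fun hr => ((h₁ x hx').2 hr).symm⟩
    have := (h₁ x hx').1 hr
    grind
  · exact (h₂ x (fun h => hx ((hmem x).2 h))).symm

/-- Kempe moves preserve properness. -/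
theorem KempeStep.proper {V : Type*} {G : SimpleGraph V} {q : ℕ} {a b : V → Fin q}
    (h : KempeStep G a b) (ha : ∀ x y, G.Adj x y → a x ≠ a y) :
    ∀ x y, G.Adj x y → b x ≠ b y := by
  obtain ⟨α, β, hne, x₀, h₁, h₂⟩ := h
  have hmem := kempe_mem_iff h₁ h₂
  intro x y hxy hb
  have hxy' := ha x y hxy
  by_cases hx : a x = α ∨ a x = β
  · have hy : a y = α ∨ a y = β := (hmem y).1 (hb ▸ (hmem x).2 hx)
    have hadj : (G.induce {y : V | a y = α ∨ a y = β}).Adj ⟨x, hx⟩ ⟨y, hy⟩ := hxy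
    by_cases hr : (G.induce {y : V | a y = α ∨ a y = β}).Reachable x₀ ⟨x, hx⟩
    · have e₁ := (h₁ x hx).1 hr
      have e₂ := (h₁ y hy).1 (hr.trans hadj.reachable)
      grind
    · have e₁ := (h₁ x hx).2 hr
      have e₂ := (h₁ y hy).2 (fun h => hr (h.trans hadj.symm.reachable))
      exact hxy' (by rw [← e₁, ← e₂, hb])
  · have hy : ¬ (a y = α ∨ a y = β) := fun h => hx ((hmem x).1 (hb ▸ (hmem y).2 h))
    exact hxy' (by rw [← h₂ x hx, ← h₂ y hy, hb])

/-- Every two-colored component can be switched by a Kempe move. -/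
theorem exists_kempe_switch {V : Type*} (G : SimpleGraph V) {q : ℕ} (a : V → Fin q)
    (α β : Fin q) (x₀ : ↥{y : V | a y = α ∨ a y = β}) :
    ∃ b : V → Fin q,
      (∀ (x : V) (hx : a x = α ∨ a x = β),
        ((G.induce {y : V | a y = α ∨ a y = β}).Reachable x₀ ⟨x, hx⟩ →
          b x = if a x = α then β else α) ∧
        (¬ (G.induce {y : V | a y = α ∨ a y = β}).Reachable x₀ ⟨x, hx⟩ → b x = a x)) ∧
      (∀ x : V, ¬ (a x = α ∨ a x = β) → b x = a x) := by
  classical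
  refine ⟨fun x => if ∃ hx : a x = α ∨ a x = β,
      (G.induce {y : V | a y = α ∨ a y = β}).Reachable x₀ ⟨x, hx⟩
    then (if a x = α then β else α) else a x, fun x hx => ⟨fun hr => ?_, fun hr => ?_⟩,
    fun x hx => ?_⟩
  · exact if_pos ⟨hx, hr⟩
  · exact if_neg (fun h => hr h.2)
  · exact if_neg (fun h => hx h.1)

/-- On a two-colored component of a bipartite graph, the color determines the side. -/
theorem color_eq_iff_side_eq {V : Type*} {G : SimpleGraph V} {q : ℕ} {a : V → Fin q}
    {f : V → Bool} (hf : ∀ x y, G.Adj x y → f x ≠ f y)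
    (ha : ∀ x y, G.Adj x y → a x ≠ a y) {α β : Fin q}
    {u v : ↥{y : V | a y = α ∨ a y = β}}
    (h : (G.induce {y : V | a y = α ∨ a y = β}).Reachable u v) :
    a u = a v ↔ f u = f v := by
  obtain ⟨w⟩ := h
  induction w with
  | nil => simp
  | @cons u v w hadj _ ih =>
    have h₁ := hf u v hadj
    have h₂ := ha u v hadj
    have hu : a u = α ∨ a u = β := u.2
    have hv : a v = α ∨ a v = β := v.2
    have hw : a w = α ∨ a w = β := w.2
    have hc : a u = a w ↔ ¬ a v = a w := by grind
    have hs : f u = f w ↔ ¬ f v = f w := by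
      cases hfu : f u <;> cases hfv : f v <;> cases hfw : f w <;> simp_all
    rw [hc, hs, ih]

/-- From a proper coloring that differs from the two-coloring `c ∘ f`, some Kempe move keeps
all the vertices that already agree with it and makes a further vertex agree. -/
theorem exists_kempeStep_improving {V : Type*} {G : SimpleGraph V} {q : ℕ} {a : V → Fin q}
    {f : V → Bool} (hf : ∀ x y, G.Adj x y → f x ≠ f y)
    (ha : ∀ x y, G.Adj x y → a x ≠ a y) {c : Bool → Fin q} (hc : Function.Injective c)
    {x₀ : V} (hx₀ : a x₀ ≠ c (f x₀)) :
    ∃ b, KempeStep G a b ∧ b x₀ = c (f x₀) ∧ ∀ x, a x = c (f x) → b x = c (f x) := by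
  obtain ⟨b, h₁, h₂⟩ := exists_kempe_switch G a (a x₀) (c (f x₀)) ⟨x₀, Or.inl rfl⟩
  refine ⟨b, ⟨_, _, hx₀, _, h₁, h₂⟩, ?_, fun x hx => ?_⟩
  · rw [(h₁ x₀ (Or.inl rfl)).1 (SimpleGraph.Reachable.refl _), if_pos rfl]
  · by_cases hm : a x = a x₀ ∨ a x = c (f x₀)
    · by_cases hr : (G.induce {y : V | a y = a x₀ ∨ a y = c (f x₀)}).Reachable
          ⟨x₀, Or.inl rfl⟩ ⟨x, hm⟩
      · have hiff : a x₀ = a x ↔ f x₀ = f x := color_eq_iff_side_eq hf ha hr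
        have : a x = c (f x₀) → f x = f x₀ := fun h => hc (hx.symm.trans h)
        grind
      · rw [(h₁ x hm).2 hr, hx]
    · rw [h₂ x hm, hx]

/-- Every proper coloring is connected by Kempe moves to the two-coloring `c ∘ f`. -/
theorem kempe_reflTransGen_twoColoring {V : Type*} [Fintype V] {G : SimpleGraph V} {q : ℕ}
    {f : V → Bool} (hf : ∀ x y, G.Adj x y → f x ≠ f y) {c : Bool → Fin q}
    (hc : Function.Injective c) (a : V → Fin q) (ha : ∀ x y, G.Adj x y → a x ≠ a y) :
    Relation.ReflTransGen
      (fun a b : V → Fin q =>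
        (∀ x y, G.Adj x y → a x ≠ a y) ∧ (∀ x y, G.Adj x y → b x ≠ b y) ∧
        KempeStep G a b)
      a (fun x => c (f x)) := by
  induction hn : (Finset.univ.filter fun x => a x ≠ c (f x)).card using Nat.strong_induction_on
    generalizing a with
  | _ n ih =>
    by_cases heq : ∀ x, a x = c (f x)
    · rw [funext heq]
    · push Not at heq
      obtain ⟨x₀, hx₀⟩ := heq
      obtain ⟨b, hab, hb₀, hb⟩ := exists_kempeStep_improving hf ha hc hx₀
      refine Relation.ReflTransGen.head ⟨ha, hab.proper ha, hab⟩
        (ih _ ?_ b (hab.proper ha) rfl)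
      rw [← hn]
      refine Finset.card_lt_card ((Finset.ssubset_iff_of_subset fun x hx => ?_).2 ⟨x₀, ?_, ?_⟩)
      · simp only [Finset.mem_filter, Finset.mem_univ, true_and] at hx ⊢
        exact fun h => hx (hb x h)
      · simpa using hx₀
      · simpa using hb₀

/-- **Ergodicity of Wang–Swendsen–Kotecký dynamics on bipartite graphs**:  if `G` is a
finite bipartite simple graph and `q ≥ 1`, then any two proper `q`-colorings of `G`
are connected by a finite sequence of proper `q`-colorings in which each coloring is
obtained from the previous one by a single Kempe (WSK) move. -/
theorem WSK_ergodic_bipartite {V : Type*} [Fintype V] (G : SimpleGraph V)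
    (hbip : ∃ f : V → Bool, ∀ x y, G.Adj x y → f x ≠ f y)
    (q : ℕ) (hq : 1 ≤ q) (σ τ : V → Fin q)
    (hσ : ∀ x y, G.Adj x y → σ x ≠ σ y) (hτ : ∀ x y, G.Adj x y → τ x ≠ τ y) :
    Relation.ReflTransGen
      (fun a b : V → Fin q =>
        (∀ x y, G.Adj x y → a x ≠ a y) ∧ (∀ x y, G.Adj x y → b x ≠ b y) ∧
        KempeStep G a b)
      σ τ := by
  obtain ⟨f, hf⟩ := hbip
  obtain rfl | hq2 : q = 1 ∨ 2 ≤ q := by omega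
  · rw [Subsingleton.elim σ τ]
  · have hc : Function.Injective
        (fun s : Bool => if s then (⟨0, by omega⟩ : Fin q) else ⟨1, by omega⟩) := by
      intro s t
      cases s <;> cases t <;> simp
    refine (kempe_reflTransGen_twoColoring hf hc σ hσ).trans ?_
    refine Relation.ReflTransGen.mono ?_ _ _ (kempe_reflTransGen_twoColoring hf hc τ hτ).swap
    exact fun _ _ h => ⟨h.2.1, h.1, h.2.2.symm⟩
end
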